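/- arXiv:1301.6068 — 12 statements merged into one kernel-verified Lean document; each statement's English description precedes it below -/
import Mathlib

section
/- Let A be a real symmetric positive definite n×n matrix with smallest and largest eigenvalues λmin and λmax. For every nonzero z ∈ ℝ^n, the steepest descent rate satisfies the Kantorovich bound: ω_z² = 1 − ‖z‖⁴ / ((z, Az)(z, A⁻¹z)) ≤ ((λmax − λmin)/(λmax + λmin))². -/
open Matrix

/-- The quadratic form of an orthogonally diagonalized matrix is a weighted sum of squares. -/
theorem dotProduct_conj_diagonal_mulVec {n : Type*} [Fintype n] [DecidableEq n]
    (U : Matrix n n ℝ) (d z : n → ℝ) :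
    z ⬝ᵥ (U * diagonal d * Uᵀ) *ᵥ z = ∑ i, d i * (Uᵀ *ᵥ z) i ^ 2 := by
  rw [← mulVec_mulVec, ← mulVec_mulVec, dotProduct_mulVec, ← mulVec_transpose]
  simp only [dotProduct, mulVec_diagonal]
  exact Finset.sum_congr rfl fun i _ => by ring

/-- The weighted Kantorovich inequality, in the form of a linear bound. -/
theorem sum_mul_add_mul_sum_inv_mul_le {ι : Type*} [Fintype ι] {d w : ι → ℝ} {m M : ℝ}
    (hd : ∀ i, 0 < d i) (hw : ∀ i, 0 ≤ w i) (hm : ∀ i, m ≤ d i) (hM : ∀ i, d i ≤ M) :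
    ∑ i, d i * w i + m * M * ∑ i, (d i)⁻¹ * w i ≤ (m + M) * ∑ i, w i := by
  rw [Finset.mul_sum, Finset.mul_sum, ← Finset.sum_add_distrib]
  refine Finset.sum_le_sum fun i _ => ?_
  have h : 0 ≤ (d i - m) * (M - d i) * (d i)⁻¹ * w i :=
    mul_nonneg (mul_nonneg (mul_nonneg (sub_nonneg.2 (hm i)) (sub_nonneg.2 (hM i)))
      (inv_nonneg.2 (hd i).le)) (hw i)
  have e : (d i - m) * (M - d i) * (d i)⁻¹ * w i
      = (m + M) * w i - (d i * w i + m * M * ((d i)⁻¹ * w i)) := by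
    have := (hd i).ne'
    field_simp
    ring
  linarith

/-- Kantorovich bound for the steepest descent rate. -/
theorem kantorovich_bound
    {n : ℕ} (hn : 0 < n) (A : Matrix (Fin n) (Fin n) ℝ) (hA : A.PosDef)
    (z : Fin n → ℝ) (hz : z ≠ 0)
    (lmin lmax : ℝ)
    (hmin : lmin = ⨅ i, hA.1.eigenvalues i)
    (hmax : lmax = ⨆ i, hA.1.eigenvalues i) :
    1 - (z ⬝ᵥ z) ^ 2 / ((z ⬝ᵥ A *ᵥ z) * (z ⬝ᵥ A⁻¹ *ᵥ z)) ≤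
      ((lmax - lmin) / (lmax + lmin)) ^ 2 := by
  have : Nonempty (Fin n) := ⟨⟨0, hn⟩⟩
  set d := hA.1.eigenvalues
  have hpos : ∀ i, 0 < d i := hA.eigenvalues_pos
  have hm : ∀ i, lmin ≤ d i := fun i => hmin ▸ ciInf_le (Set.finite_range d).bddBelow i
  have hM : ∀ i, d i ≤ lmax := fun i => hmax ▸ le_ciSup (Set.finite_range d).bddAbove i
  have hm0 : 0 < lmin := by
    obtain ⟨i, hi⟩ := exists_eq_ciInf_of_finite (f := d)
    rw [hmin, ← hi]
    exact hpos i
  have hM0 : 0 < lmax := hm0.trans_le ((hm ⟨0, hn⟩).trans (hM ⟨0, hn⟩))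
  set U : Matrix (Fin n) (Fin n) ℝ := hA.1.eigenvectorUnitary.1
  have hUU : U * Uᵀ = 1 := by
    simpa [star_eq_conjTranspose] using Unitary.coe_mul_star_self hA.1.eigenvectorUnitary
  have hUU' : Uᵀ * U = 1 := mul_eq_one_comm.1 hUU
  have hAd : A = U * diagonal d * Uᵀ := by
    have h := hA.1.spectral_theorem
    rw [Unitary.conjStarAlgAut_apply] at h
    simpa [star_eq_conjTranspose, Function.comp_def] using h
  have hAinv : A⁻¹ = U * diagonal (fun i => (d i)⁻¹) * Uᵀ := by
    apply inv_eq_right_inv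
    have hdd : diagonal d * diagonal (fun i => (d i)⁻¹) = 1 := by
      rw [diagonal_mul_diagonal, ← diagonal_one]
      congr 1
      exact funext fun i => mul_inv_cancel₀ (hpos i).ne'
    calc A * (U * diagonal (fun i => (d i)⁻¹) * Uᵀ)
        = U * diagonal d * (Uᵀ * U) * diagonal (fun i => (d i)⁻¹) * Uᵀ := by
          conv_lhs => rw [hAd]
          simp only [Matrix.mul_assoc]
      _ = 1 := by rw [hUU', Matrix.mul_one, Matrix.mul_assoc U, hdd, Matrix.mul_one, hUU]
  have ha : 0 < z ⬝ᵥ A *ᵥ z := by simpa using hA.dotProduct_mulVec_pos hz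
  have hb : 0 < z ⬝ᵥ A⁻¹ *ᵥ z := by simpa using hA.inv.dotProduct_mulVec_pos hz
  have key : z ⬝ᵥ A *ᵥ z + lmin * lmax * (z ⬝ᵥ A⁻¹ *ᵥ z) ≤ (lmin + lmax) * (z ⬝ᵥ z) := by
    have hs : z ⬝ᵥ z = ∑ i, (Uᵀ *ᵥ z) i ^ 2 := by
      simpa [hUU] using dotProduct_conj_diagonal_mulVec U (fun _ => 1) z
    have h1 : z ⬝ᵥ A *ᵥ z = ∑ i, d i * (Uᵀ *ᵥ z) i ^ 2 := by
      rw [← dotProduct_conj_diagonal_mulVec, ← hAd]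
    rw [h1, hAinv, hs, dotProduct_conj_diagonal_mulVec]
    exact sum_mul_add_mul_sum_inv_mul_le hpos (fun i => sq_nonneg _) hm hM
  generalize z ⬝ᵥ A *ᵥ z = a at *
  generalize z ⬝ᵥ A⁻¹ *ᵥ z = b at *
  generalize z ⬝ᵥ z = s at *
  have hsq : 4 * lmin * lmax * (a * b) ≤ s ^ 2 * (lmax + lmin) ^ 2 := by
    have h := pow_le_pow_left₀ (by positivity) key 2
    nlinarith [sq_nonneg (a - lmin * lmax * b)]
  have hrate : 4 * lmin * lmax / (lmax + lmin) ^ 2 ≤ s ^ 2 / (a * b) := by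
    rwa [div_le_div_iff₀ (by positivity) (by positivity)]
  have hid : ((lmax - lmin) / (lmax + lmin)) ^ 2
      = 1 - 4 * lmin * lmax / (lmax + lmin) ^ 2 := by
    have : lmax + lmin ≠ 0 := by positivity
    field_simp
    ring
  linarith
end

section
/- (Theorem 1, perturbed steepest descent.) Let A be a real symmetric positive definite n×n matrix, x_* = A⁻¹y, t an initial guess, c = x_* − t, and z = y − At the residual. Suppose z = z̃ + δz with z̃ ≠ 0, (z̃, δz) = 0, and ‖δz‖_A ≤ ε‖z̃‖_A ≤ ε‖z‖_A for some ε ≥ 0. Then the perturbed steepest descent step x = t + z̃·(‖z̃‖²/‖z̃‖_A²) has error d̃ = x_* − x satisfying ‖d̃‖_A ≤ ( ω_z + ε√(2(1 − ω_z²)) + (1/(2√2)) ε³ cond²(A) ) ‖c‖_A, where ω_z² = 1 − ‖z‖⁴/((z,Az)(z,A⁻¹z)) and cond(A) = λmax(A)/λmin(A). -/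
open Matrix

/-- The A-norm `‖u‖_A = √(uᵀAu)`. -/
noncomputable def anorm {n : ℕ} (A : Matrix (Fin n) (Fin n) ℝ) (u : Fin n → ℝ) : ℝ :=
  Real.sqrt (u ⬝ᵥ A *ᵥ u)

/-- The A-orthogonal projector onto span{z}: `R_z = z zᵀ A / (zᵀAz)`. -/
noncomputable def Rvec {n : ℕ} (A : Matrix (Fin n) (Fin n) ℝ) (z : Fin n → ℝ) :
    Matrix (Fin n) (Fin n) ℝ :=
  (z ⬝ᵥ A *ᵥ z)⁻¹ • (Matrix.vecMulVec z z * A)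

/-- The A-orthogonal projector onto the column span of Z: `R_Z = Z (ZᵀAZ)⁻¹ Zᵀ A`. -/
noncomputable def Rmat {n m : ℕ} (A : Matrix (Fin n) (Fin n) ℝ) (Z : Matrix (Fin n) (Fin m) ℝ) :
    Matrix (Fin n) (Fin n) ℝ :=
  Z * (Zᵀ * A * Z)⁻¹ * Zᵀ * A

/-- The A-norm is a Euclidean norm after a linear change of variables. -/
lemma exists_anorm_eq_norm {n : ℕ} {A : Matrix (Fin n) (Fin n) ℝ} (hA : A.PosSemidef) :
    ∃ B : Matrix (Fin n) (Fin n) ℝ, ∀ u, anorm A u = ‖WithLp.toLp 2 (B *ᵥ u)‖ := by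
  obtain ⟨B, hB⟩ : ∃ B : Matrix (Fin n) (Fin n) ℝ, A = Bᴴ * B := by
    open scoped MatrixOrder in
    exact CStarAlgebra.nonneg_iff_eq_star_mul_self.mp hA.nonneg
  refine ⟨B, fun u => ?_⟩
  rw [anorm, EuclideanSpace.norm_eq, hB, ← mulVec_mulVec, conjTranspose_eq_transpose_of_trivial,
    dotProduct_mulVec, vecMul_transpose]
  simp [dotProduct, sq]

lemma anorm_add_le {n : ℕ} {A : Matrix (Fin n) (Fin n) ℝ} (hA : A.PosSemidef)
    (u v : Fin n → ℝ) : anorm A (u + v) ≤ anorm A u + anorm A v := by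
  obtain ⟨B, hB⟩ := exists_anorm_eq_norm hA
  simpa only [hB, mulVec_add, WithLp.toLp_add] using norm_add_le _ _

lemma anorm_smul {n : ℕ} {A : Matrix (Fin n) (Fin n) ℝ} (hA : A.PosSemidef)
    (a : ℝ) (u : Fin n → ℝ) : anorm A (a • u) = |a| * anorm A u := by
  obtain ⟨B, hB⟩ := exists_anorm_eq_norm hA
  simp only [hB, mulVec_smul, WithLp.toLp_smul, norm_smul, Real.norm_eq_abs]

/-- Expansion of the quadratic form along a line. -/
lemma dotProduct_mulVec_sub_smul {n : ℕ} {A : Matrix (Fin n) (Fin n) ℝ} (hA : A.IsHermitian)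
    (c v : Fin n → ℝ) (a : ℝ) :
    (c - a • v) ⬝ᵥ A *ᵥ (c - a • v) =
      c ⬝ᵥ A *ᵥ c - 2 * a * (v ⬝ᵥ A *ᵥ c) + a ^ 2 * (v ⬝ᵥ A *ᵥ v) := by
  have hsymm : c ⬝ᵥ A *ᵥ v = v ⬝ᵥ A *ᵥ c := by
    have hT : Aᵀ = A := by rw [← conjTranspose_eq_transpose_of_trivial]; exact hA
    rw [dotProduct_mulVec, ← mulVec_transpose, hT, dotProduct_comm]
  simp only [mulVec_sub, mulVec_smul, sub_dotProduct, dotProduct_sub, smul_dotProduct,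
    dotProduct_smul, smul_eq_mul, hsymm]
  ring

/-- An exact line search minimizes the A-norm of the error along the search direction. -/
lemma anorm_sub_lineSearch_le {n : ℕ} {A : Matrix (Fin n) (Fin n) ℝ} (hA : A.PosDef)
    (c : Fin n → ℝ) {v : Fin n → ℝ} (hv : v ≠ 0) (a : ℝ) :
    anorm A (c - ((v ⬝ᵥ A *ᵥ c) / (v ⬝ᵥ A *ᵥ v)) • v) ≤ anorm A (c - a • v) := by
  have hQ : 0 < v ⬝ᵥ A *ᵥ v := by simpa using hA.dotProduct_mulVec_pos hv
  refine Real.sqrt_le_sqrt ?_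
  rw [dotProduct_mulVec_sub_smul hA.1, dotProduct_mulVec_sub_smul hA.1]
  have h : 0 ≤ (v ⬝ᵥ A *ᵥ v) * (a - (v ⬝ᵥ A *ᵥ c) / (v ⬝ᵥ A *ᵥ v)) ^ 2 := by positivity
  have hN : (v ⬝ᵥ A *ᵥ c) / (v ⬝ᵥ A *ᵥ v) * (v ⬝ᵥ A *ᵥ v) = v ⬝ᵥ A *ᵥ c :=
    div_mul_cancel₀ _ hQ.ne'
  linear_combination h - 2 * (a - (v ⬝ᵥ A *ᵥ c) / (v ⬝ᵥ A *ᵥ v)) * hN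

/-- Theorem 1: progress of the perturbed steepest descent step. -/
theorem perturbed_steepest_descent
    {n : ℕ} (hn : 0 < n) (A : Matrix (Fin n) (Fin n) ℝ) (hA : A.PosDef)
    (y t xstar c z zt δz x dt : Fin n → ℝ) (ε : ℝ) (hε : 0 ≤ ε)
    (hxstar : xstar = A⁻¹ *ᵥ y)
    (hc : c = xstar - t)
    (hz : z = y - A *ᵥ t)
    (hsplit : z = zt + δz) (hzt0 : zt ≠ 0)
    (horth : zt ⬝ᵥ δz = 0)
    (hpert1 : anorm A δz ≤ ε * anorm A zt)
    (hpert2 : ε * anorm A zt ≤ ε * anorm A z)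
    (hx : x = t + ((zt ⬝ᵥ zt) / (zt ⬝ᵥ A *ᵥ zt)) • zt)
    (hdt : dt = xstar - x)
    (ωz lmin lmax condA : ℝ)
    (hω : ωz = Real.sqrt (1 - (z ⬝ᵥ z) ^ 2 / ((z ⬝ᵥ A *ᵥ z) * (z ⬝ᵥ A⁻¹ *ᵥ z))))
    (hmin : lmin = ⨅ i, hA.1.eigenvalues i)
    (hmax : lmax = ⨆ i, hA.1.eigenvalues i)
    (hcond : condA = lmax / lmin) :
    anorm A dt ≤
      (ωz + ε * Real.sqrt (2 * (1 - ωz ^ 2)) + (1 / (2 * Real.sqrt 2)) * ε ^ 3 * condA ^ 2) *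
        anorm A c := by
  have hP := hA.posSemidef
  have hdet : IsUnit A.det := (isUnit_iff_isUnit_det A).mp hA.isUnit
  have hAc : A *ᵥ c = z := by
    rw [hc, hxstar, hz, mulVec_sub, mulVec_mulVec, mul_nonsing_inv A hdet, one_mulVec]
  have hcz : A⁻¹ *ᵥ z = c := by
    rw [← hAc, mulVec_mulVec, nonsing_inv_mul A hdet, one_mulVec]
  have hztz : zt ⬝ᵥ A *ᵥ c = zt ⬝ᵥ zt := by rw [hAc, hsplit, dotProduct_add, horth, add_zero]
  have hz0 : z ≠ 0 := by
    intro h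
    rw [hAc, h, dotProduct_zero] at hztz
    exact hzt0 (dotProduct_self_eq_zero.mp hztz.symm)
  have hc0 : c ≠ 0 := by
    rintro rfl
    exact hz0 (by rw [← hAc, mulVec_zero])
  have hT : 0 < z ⬝ᵥ A *ᵥ z := by simpa using hA.dotProduct_mulVec_pos hz0
  have hK : 0 < c ⬝ᵥ A *ᵥ c := by simpa using hA.dotProduct_mulVec_pos hc0
  have hzK : z ⬝ᵥ A⁻¹ *ᵥ z = c ⬝ᵥ A *ᵥ c := by rw [hcz, hAc, dotProduct_comm]
  have hS : 0 < z ⬝ᵥ z := by simpa using dotProduct_star_self_pos_iff.mpr hz0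
  have hnc : anorm A c = √(c ⬝ᵥ A *ᵥ c) := rfl
  have hnz : anorm A z = √(z ⬝ᵥ A *ᵥ z) := rfl
  have hexact : anorm A (c - ((z ⬝ᵥ z) / (z ⬝ᵥ A *ᵥ z)) • z) =
      √(c ⬝ᵥ A *ᵥ c - (z ⬝ᵥ z) ^ 2 / (z ⬝ᵥ A *ᵥ z)) := by
    rw [anorm, dotProduct_mulVec_sub_smul hA.1, hAc]
    congr 1
    field_simp
    ring
  have hquad := hP.dotProduct_mulVec_nonneg (c - ((z ⬝ᵥ z) / (z ⬝ᵥ A *ᵥ z)) • z)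
  rw [star_trivial, dotProduct_mulVec_sub_smul hA.1, hAc] at hquad
  rw [hzK] at hω
  rw [hAc] at hK hnc hexact hω
  generalize hSg : z ⬝ᵥ z = S at *
  generalize hTg : z ⬝ᵥ A *ᵥ z = T at *
  generalize hKg : c ⬝ᵥ z = K at *
  have hsq : S ^ 2 / (T * K) ≤ 1 := by
    rw [div_le_one (by positivity)]
    have h : K - 2 * (S / T) * S + (S / T) ^ 2 * T = (T * K - S ^ 2) / T := by
      field_simp
      ring
    rw [h, le_div_iff₀ hT] at hquad
    linarith
  have hω2 : ωz ^ 2 = 1 - S ^ 2 / (T * K) := by rw [hω, Real.sq_sqrt (by linarith)]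
  have hfirst : anorm A (c - (S / T) • z) = ωz * anorm A c := by
    rw [hexact, hω, hnc, ← Real.sqrt_mul (by linarith)]
    congr 1
    field_simp
  have hsecond : S / T * anorm A z ≤ √(2 * (1 - ωz ^ 2)) * anorm A c := by
    rw [hnc, hnz, hω2, ← Real.sqrt_mul (by rw [sub_sub_cancel]; positivity)]
    refine Real.le_sqrt_of_sq_le ?_
    rw [mul_pow, Real.sq_sqrt hT.le, sub_sub_cancel]
    have h1 : (S / T) ^ 2 * T = S ^ 2 / T := by field_simp
    have h2 : 2 * (S ^ 2 / (T * K)) * K = 2 * (S ^ 2 / T) := by field_simp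
    have h3 : 0 ≤ S ^ 2 / T := by positivity
    linarith
  have hthird : 0 ≤ (1 / (2 * √2)) * ε ^ 3 * condA ^ 2 * anorm A c := by
    rw [hnc]
    positivity
  have hdt' : dt = c - ((zt ⬝ᵥ A *ᵥ c) / (zt ⬝ᵥ A *ᵥ zt)) • zt := by
    rw [hztz, hdt, hx, hc, sub_sub]
  have hsum : c - (S / T) • zt = (c - (S / T) • z) + (S / T) • δz := by
    rw [hsplit, smul_add]
    abel
  calc anorm A dt ≤ anorm A (c - (S / T) • zt) := hdt' ▸ anorm_sub_lineSearch_le hA c hzt0 _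
    _ ≤ ωz * anorm A c + S / T * anorm A δz := by
      rw [hsum, ← hfirst]
      refine (anorm_add_le hP _ _).trans_eq ?_
      rw [anorm_smul hP, abs_of_pos (div_pos hS hT)]
    _ ≤ ωz * anorm A c + S / T * (ε * anorm A z) := by
      gcongr
      exact hpert1.trans hpert2
    _ ≤ ωz * anorm A c + ε * (√(2 * (1 - ωz ^ 2)) * anorm A c) := by
      rw [mul_left_comm]
      gcongr
    _ ≤ _ := by linarith
end

section
/- Let A be a real symmetric positive definite n×n matrix and let z, z̃ ∈ ℝ^n be nonzero with z = z̃ + δz. Then the A-orthogonal rank-one projectors satisfy the identity R_z − R_{z̃} = (z̃ δzᵀ/‖z̃‖_A²)(I − R_zᵀ)A + (I − R_{z̃})(δz zᵀ/‖z‖_A²)A. -/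
open Matrix

/-- A product of rank-one matrices with `A` in between is rank one, scaled by the `A`-pairing. -/
theorem vecMulVec_mul_mul_vecMulVec {n : ℕ} (A : Matrix (Fin n) (Fin n) ℝ)
    (a b c d : Fin n → ℝ) :
    vecMulVec a b * A * vecMulVec c d = (b ⬝ᵥ A *ᵥ c) • vecMulVec a d := by
  rw [Matrix.mul_assoc, mul_vecMulVec, vecMulVec_mul_vecMulVec, vecMulVec_smul]

/-- rank-one A-orthogonal projector perturbation identity. -/
theorem projector_perturbation_identity
    {n : ℕ} (A : Matrix (Fin n) (Fin n) ℝ) (hA : A.PosDef)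
    (z zt δz : Fin n → ℝ) (hz : z ≠ 0) (hzt : zt ≠ 0)
    (hsplit : z = zt + δz) :
    Rvec A z - Rvec A zt =
      ((zt ⬝ᵥ A *ᵥ zt)⁻¹ • Matrix.vecMulVec zt δz) * (1 - (Rvec A z)ᵀ) * A +
      (1 - Rvec A zt) * ((z ⬝ᵥ A *ᵥ z)⁻¹ • Matrix.vecMulVec δz z) * A := by
  have hsym : Aᵀ = A := hA.isHermitian
  have ha : z ⬝ᵥ A *ᵥ z ≠ 0 := (hA.dotProduct_mulVec_pos hz).ne'
  have hb : zt ⬝ᵥ A *ᵥ zt ≠ 0 := (hA.dotProduct_mulVec_pos hzt).ne'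
  have hδ : δz = z - zt := by simp [hsplit]
  have hRt : (Rvec A z)ᵀ = (z ⬝ᵥ A *ᵥ z)⁻¹ • (A * vecMulVec z z) := by
    simp [Rvec, transpose_mul, hsym, transpose_vecMulVec]
  rw [hRt]
  simp only [Rvec, Matrix.mul_sub, Matrix.sub_mul, Matrix.mul_one, Matrix.one_mul,
    Matrix.smul_mul, Matrix.mul_smul, ← Matrix.mul_assoc, vecMulVec_mul_mul_vecMulVec]
  rw [hδ]
  simp only [vecMulVec_sub, sub_vecMulVec, sub_dotProduct, mulVec_sub, dotProduct_sub,
    Matrix.sub_mul]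
  generalize z ⬝ᵥ A *ᵥ z = a at *
  generalize zt ⬝ᵥ A *ᵥ zt = b at *
  match_scalars <;> field_simp
  ring
end

section
/- Let A be a real symmetric positive definite n×n matrix, and let z = z̃ + δz with z ≠ 0 and (z̃, δz) = 0. With γ = ‖z‖²/‖z‖_A², one has ‖A⁻¹δz − γz‖_A² = γ²‖z‖_A² + ‖δz‖²_{A⁻¹} − 2γ‖δz‖², and consequently ‖A⁻¹δz − γz‖_A² ≤ γ²‖z‖_A² + ‖δz‖²_{A⁻¹}. -/
open Matrix

/-- norm expansion of `A⁻¹δz − γz` in the A-norm. -/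
theorem norm_expansion
    {n : ℕ} (A : Matrix (Fin n) (Fin n) ℝ) (hA : A.PosDef)
    (z zt δz : Fin n → ℝ) (hz : z ≠ 0)
    (hsplit : z = zt + δz) (horth : zt ⬝ᵥ δz = 0)
    (γ : ℝ) (hγ : γ = (z ⬝ᵥ z) / (z ⬝ᵥ A *ᵥ z))
    (w : Fin n → ℝ) (hw : w = A⁻¹ *ᵥ δz - γ • z) :
    w ⬝ᵥ A *ᵥ w =
      γ ^ 2 * (z ⬝ᵥ A *ᵥ z) + δz ⬝ᵥ A⁻¹ *ᵥ δz - 2 * γ * (δz ⬝ᵥ δz) ∧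
    w ⬝ᵥ A *ᵥ w ≤ γ ^ 2 * (z ⬝ᵥ A *ᵥ z) + δz ⬝ᵥ A⁻¹ *ᵥ δz := by
  have hA_inv : A *ᵥ A⁻¹ *ᵥ δz = δz := by
    rw [mulVec_mulVec, mul_nonsing_inv A hA.det_pos.ne'.isUnit, one_mulVec]
  have hAt : Aᵀ = A := by simpa using hA.isHermitian.eq
  have hzδ : z ⬝ᵥ δz = δz ⬝ᵥ δz := by rw [hsplit, add_dotProduct, horth, zero_add]
  have hcross : A⁻¹ *ᵥ δz ⬝ᵥ A *ᵥ z = δz ⬝ᵥ δz := by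
    rw [dotProduct_mulVec, ← mulVec_transpose, hAt, hA_inv, dotProduct_comm, hzδ]
  have hexp : w ⬝ᵥ A *ᵥ w =
      γ ^ 2 * (z ⬝ᵥ A *ᵥ z) + δz ⬝ᵥ A⁻¹ *ᵥ δz - 2 * γ * (δz ⬝ᵥ δz) := by
    rw [hw, mulVec_sub, hA_inv, mulVec_smul]
    simp only [sub_dotProduct, dotProduct_sub, smul_dotProduct, dotProduct_smul, smul_eq_mul,
      hcross, hzδ, dotProduct_comm (A⁻¹ *ᵥ δz) δz]
    ring
  have hsq (v : Fin n → ℝ) : 0 ≤ v ⬝ᵥ v := by simpa using dotProduct_star_self_nonneg v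
  have hγ_nonneg : 0 ≤ γ := by
    rw [hγ]
    exact div_nonneg (hsq z) (by simpa using (hA.dotProduct_mulVec_pos hz).le)
  refine ⟨hexp, ?_⟩
  linarith [mul_nonneg hγ_nonneg (hsq δz)]
end

section
/- Let A be a real symmetric positive definite n×n matrix, x_* = A⁻¹y, t an initial guess with error c = x_* − t, and z = y − At. Suppose z = z̃ + δz with z̃ ≠ 0, (z̃, δz) = 0, and ‖δz‖_A ≤ ε‖z̃‖_A ≤ ε‖z‖_A. Let d = c − z·(‖z‖²/‖z‖_A²) be the error of the exact steepest descent step and d̃ = c − z̃·(‖z̃‖²/‖z̃‖_A²) the error of the perturbed step. Then ‖d̃ − d‖_A² ≤ ε² ( 2‖z‖⁴/‖z‖_A² + ‖δz‖²_{A⁻¹} ). -/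
open Matrix

/-- The quadratic form of a symmetric matrix on a linear combination. -/
lemma dotProduct_mulVec_linear_combination {n : ℕ} {A : Matrix (Fin n) (Fin n) ℝ}
    (hA : A.IsSymm) (x y : ℝ) (u v : Fin n → ℝ) :
    (x • u + y • v) ⬝ᵥ A *ᵥ (x • u + y • v) =
      x ^ 2 * (u ⬝ᵥ A *ᵥ u) + 2 * (x * y) * (u ⬝ᵥ A *ᵥ v) + y ^ 2 * (v ⬝ᵥ A *ᵥ v) := by
  have hsymm : v ⬝ᵥ A *ᵥ u = u ⬝ᵥ A *ᵥ v := by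
    rw [dotProduct_mulVec, ← mulVec_transpose, hA.eq, dotProduct_comm]
  simp only [mulVec_add, mulVec_smul, add_dotProduct, dotProduct_add, smul_dotProduct,
    dotProduct_smul, smul_eq_mul, hsymm]
  ring

/-- The Cauchy-Schwarz inequality `‖u‖⁴ ≤ ‖u‖_A² ‖u‖_{A⁻¹}²`. -/
lemma dotProduct_self_sq_le {n : ℕ} {A : Matrix (Fin n) (Fin n) ℝ} (hA : A.PosDef)
    (u : Fin n → ℝ) :
    (u ⬝ᵥ u) ^ 2 ≤ (u ⬝ᵥ A *ᵥ u) * (u ⬝ᵥ A⁻¹ *ᵥ u) := by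
  have hsymm : A.IsSymm := by simpa using hA.isHermitian
  have hAv : A *ᵥ (A⁻¹ *ᵥ u) = u := by
    rw [mulVec_mulVec, mul_nonsing_inv _ ((isUnit_iff_isUnit_det A).mp hA.isUnit), one_mulVec]
  have hdisc := discrim_le_zero (a := u ⬝ᵥ A⁻¹ *ᵥ u) (b := 2 * (u ⬝ᵥ u)) (c := u ⬝ᵥ A *ᵥ u)
    fun x => by
      have h := hA.posSemidef.dotProduct_mulVec_nonneg ((1 : ℝ) • u + x • (A⁻¹ *ᵥ u))
      rw [star_trivial, dotProduct_mulVec_linear_combination hsymm, hAv,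
        dotProduct_comm (A⁻¹ *ᵥ u) u] at h
      linarith
  rw [discrim] at hdisc
  linarith

/-- The scalar form of the steepest descent perturbation bound: here `p = ‖z̃‖²`, `q = ‖δz‖²`,
`a = ‖z̃‖_A²`, `b = (z̃, δz)_A`, `e = ‖δz‖_A²`, `D = ‖δz‖²_{A⁻¹}`. -/
lemma sd_step_scalar_bound {p q a b e D ε : ℝ} (hp : 0 ≤ p) (hq : 0 ≤ q) (ha : 0 < a)
    (hM : 0 < a + 2 * b + e) (hD : 0 ≤ D) (hcs : q ^ 2 ≤ e * D) (he : e ≤ ε ^ 2 * a)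
    (hbe : 0 ≤ (b + e) * q) :
    (p + q) ^ 2 / (a + 2 * b + e)
        - 2 * ((p + q) / (a + 2 * b + e)) * (p / a) * (a + b) + p ^ 2 / a ≤
      ε ^ 2 * (2 * (p + q) ^ 2 / (a + 2 * b + e) + D) := by
  calc
    _ = (q ^ 2 - 2 * ((b + e) * q) * (p + q) / (a + 2 * b + e)
          + e * ((p + q) ^ 2 / (a + 2 * b + e))) / a := by
        field_simp
        ring
    _ ≤ ε ^ 2 * a * (2 * (p + q) ^ 2 / (a + 2 * b + e) + D) / a := by
        have hcross : 0 ≤ 2 * ((b + e) * q) * (p + q) / (a + 2 * b + e) := by positivity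
        have hN : 0 ≤ (p + q) ^ 2 / (a + 2 * b + e) := by positivity
        have heN := mul_le_mul_of_nonneg_right he hN
        have heD := mul_le_mul_of_nonneg_right he hD
        have hεN : 0 ≤ ε ^ 2 * a * ((p + q) ^ 2 / (a + 2 * b + e)) := by positivity
        gcongr
        rw [mul_div_assoc 2 ((p + q) ^ 2)]
        linarith
    _ = _ := by field_simp

/-- bound on the A-norm of the difference between the perturbed and
the exact steepest descent errors. -/
theorem perturbation_of_sd_step
    {n : ℕ} (A : Matrix (Fin n) (Fin n) ℝ) (hA : A.PosDef)
    (y t xstar c z zt δz d dt : Fin n → ℝ) (ε : ℝ)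
    (hxstar : xstar = A⁻¹ *ᵥ y)
    (hc : c = xstar - t)
    (hz : z = y - A *ᵥ t)
    (hsplit : z = zt + δz) (hzt0 : zt ≠ 0)
    (horth : zt ⬝ᵥ δz = 0)
    (hpert1 : anorm A δz ≤ ε * anorm A zt)
    (hpert2 : ε * anorm A zt ≤ ε * anorm A z)
    (hd : d = c - ((z ⬝ᵥ z) / (z ⬝ᵥ A *ᵥ z)) • z)
    (hdt : dt = c - ((zt ⬝ᵥ zt) / (zt ⬝ᵥ A *ᵥ zt)) • zt) :
    (dt - d) ⬝ᵥ A *ᵥ (dt - d) ≤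
      ε ^ 2 * (2 * (z ⬝ᵥ z) ^ 2 / (z ⬝ᵥ A *ᵥ z) + δz ⬝ᵥ A⁻¹ *ᵥ δz) := by
  have hsymm : A.IsSymm := by simpa using hA.isHermitian
  have hpos : ∀ u : Fin n → ℝ, 0 ≤ u ⬝ᵥ A *ᵥ u := fun u => by
    simpa using hA.posSemidef.dotProduct_mulVec_nonneg u
  have ha : 0 < zt ⬝ᵥ A *ᵥ zt := by simpa using hA.dotProduct_mulVec_pos hzt0
  have hD : 0 ≤ δz ⬝ᵥ A⁻¹ *ᵥ δz := by
    simpa using hA.inv.posSemidef.dotProduct_mulVec_nonneg δz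
  have hp : 0 < zt ⬝ᵥ zt := by simpa using dotProduct_star_self_pos_iff.mpr hzt0
  have hq : 0 ≤ δz ⬝ᵥ δz := by simpa using dotProduct_star_self_nonneg δz
  have hcs := dotProduct_self_sq_le hA δz
  have hN : z ⬝ᵥ z = zt ⬝ᵥ zt + δz ⬝ᵥ δz := by
    simp [hsplit, add_dotProduct, dotProduct_add, horth, dotProduct_comm δz zt]
  have hz0 : z ≠ 0 := by
    rintro h
    rw [h, zero_dotProduct] at hN
    linarith
  have hMpos : 0 < z ⬝ᵥ A *ᵥ z := by simpa using hA.dotProduct_mulVec_pos hz0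
  have hM : z ⬝ᵥ A *ᵥ z = zt ⬝ᵥ A *ᵥ zt + 2 * (zt ⬝ᵥ A *ᵥ δz) + δz ⬝ᵥ A *ᵥ δz := by
    simpa [← hsplit] using dotProduct_mulVec_linear_combination hsymm 1 1 zt δz
  have hzAzt : z ⬝ᵥ A *ᵥ zt = zt ⬝ᵥ A *ᵥ zt + zt ⬝ᵥ A *ᵥ δz := by
    rw [hsplit, add_dotProduct, dotProduct_mulVec δz, ← mulVec_transpose, hsymm.eq,
      dotProduct_comm (A *ᵥ δz)]
  unfold anorm at hpert1 hpert2
  have he : δz ⬝ᵥ A *ᵥ δz ≤ ε ^ 2 * (zt ⬝ᵥ A *ᵥ zt) := by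
    have h := pow_le_pow_left₀ (Real.sqrt_nonneg _) hpert1 2
    rwa [mul_pow, Real.sq_sqrt (hpos _), Real.sq_sqrt (hpos _)] at h
  have hε : 0 ≤ ε :=
    nonneg_of_mul_nonneg_left ((Real.sqrt_nonneg _).trans hpert1) (Real.sqrt_pos.mpr ha)
  have hbe : 0 ≤ (zt ⬝ᵥ A *ᵥ δz + δz ⬝ᵥ A *ᵥ δz) * (δz ⬝ᵥ δz) := by
    rcases hε.eq_or_lt with rfl | hε
    · have he0 : δz ⬝ᵥ A *ᵥ δz = 0 := le_antisymm (by simpa using he) (hpos δz)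
      have hq0 : δz ⬝ᵥ δz = 0 := by
        rw [he0, zero_mul] at hcs
        exact pow_eq_zero_iff two_ne_zero |>.mp (le_antisymm hcs (sq_nonneg _))
      simp [hq0]
    · have h := (Real.sqrt_le_sqrt_iff (hpos z)).mp (le_of_mul_le_mul_left hpert2 hε)
      exact mul_nonneg (by linarith [hpos δz]) hq
  have hdiff : dt - d = ((z ⬝ᵥ z) / (z ⬝ᵥ A *ᵥ z)) • z +
      (-((zt ⬝ᵥ zt) / (zt ⬝ᵥ A *ᵥ zt))) • zt := by
    rw [hd, hdt, neg_smul]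
    abel
  rw [hdiff, dotProduct_mulVec_linear_combination hsymm, hzAzt]
  rw [hM] at hMpos
  rw [hM, hN]
  refine le_trans (le_of_eq ?_) (sd_step_scalar_bound hp.le hq ha hMpos hD hcs he hbe)
  have ha' := ha.ne'
  have hM' := hMpos.ne'
  field_simp
  ring
end

section
/- Let A be a real symmetric positive definite n×n matrix, c ∈ ℝ^n nonzero, z = Ac, and s ∈ ℝ^n nonzero with (z, s) = 0. Let Z = [z s] and define ω_z² = (c,(I − R_z)c)_A/(c,c)_A and ω_Z² = (c,(I − R_Z)c)_A/(c,c)_A. Then 1 − ω_Z² = ‖z‖⁴‖s‖_A² / ( ‖z‖²_{A⁻¹} ( ‖s‖_A²‖z‖_A² − (s,z)_A² ) ) and (1 − ω_z²)/(1 − ω_Z²) = 1 − (s,z)_A² / ( ‖s‖_A²‖z‖_A² ) ≤ 1; in particular ω_Z ≤ ω_z. -/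
open Matrix

theorem Matrix.IsSymm.dotProduct_mulVec_comm {ι : Type*} [Fintype ι] {A : Matrix ι ι ℝ}
    (hA : A.IsSymm) (u v : ι → ℝ) : u ⬝ᵥ A *ᵥ v = v ⬝ᵥ A *ᵥ u := by
  rw [dotProduct_mulVec, dotProduct_comm, ← mulVec_transpose, hA.eq]

theorem dotProduct_mulVec_Rvec {n : ℕ} {A : Matrix (Fin n) (Fin n) ℝ} (hA : A.IsSymm)
    (z c : Fin n → ℝ) :
    c ⬝ᵥ A *ᵥ (Rvec A z *ᵥ c) = (z ⬝ᵥ A *ᵥ c) ^ 2 / (z ⬝ᵥ A *ᵥ z) := by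
  rw [Rvec, smul_mulVec, ← mulVec_mulVec, vecMulVec_mulVec, mulVec_smul, op_smul_eq_smul,
    mulVec_smul, dotProduct_smul, dotProduct_smul, hA.dotProduct_mulVec_comm c z]
  simp only [smul_eq_mul]
  ring

theorem dotProduct_mulVec_Rmat {n m : ℕ} {A : Matrix (Fin n) (Fin n) ℝ} (hA : A.IsSymm)
    (Z : Matrix (Fin n) (Fin m) ℝ) (c : Fin n → ℝ) :
    c ⬝ᵥ A *ᵥ (Rmat A Z *ᵥ c) =
      (Zᵀ *ᵥ (A *ᵥ c)) ⬝ᵥ (Zᵀ * A * Z)⁻¹ *ᵥ (Zᵀ *ᵥ (A *ᵥ c)) := by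
  rw [Rmat, dotProduct_mulVec, ← mulVec_transpose, hA.eq]
  simp only [← mulVec_mulVec]
  rw [dotProduct_mulVec, ← mulVec_transpose]

/-- Strict Cauchy–Schwarz inequality for the A-inner product, for vectors that are orthogonal
with respect to the Euclidean one. -/
theorem Matrix.PosDef.sq_dotProduct_mulVec_lt_of_dotProduct_eq_zero {ι : Type*} [Fintype ι]
    {A : Matrix ι ι ℝ} (hA : A.PosDef) {z s : ι → ℝ} (hz : z ≠ 0) (hs : s ≠ 0)
    (h : z ⬝ᵥ s = 0) :
    (s ⬝ᵥ A *ᵥ z) ^ 2 < (s ⬝ᵥ A *ᵥ s) * (z ⬝ᵥ A *ᵥ z) := by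
  have hsymm : A.IsSymm := by simpa using hA.isHermitian
  have hq : 0 < s ⬝ᵥ A *ᵥ s := by simpa using hA.dotProduct_mulVec_pos hs
  have hv : (s ⬝ᵥ A *ᵥ s) • z - (s ⬝ᵥ A *ᵥ z) • s ≠ 0 := by
    intro h0
    have := congrArg (z ⬝ᵥ ·) h0
    simp [dotProduct_sub, dotProduct_smul, h, hq.ne', hz] at this
  have hpos := hA.dotProduct_mulVec_pos hv
  simp only [star_trivial, mulVec_sub, mulVec_smul, dotProduct_sub, sub_dotProduct,
    dotProduct_smul, smul_dotProduct, smul_eq_mul, hsymm.dotProduct_mulVec_comm z s] at hpos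
  nlinarith

/-- sharpness of the inequality `ω_Z ≤ ω_z` for `Z = [z s]`. -/
theorem two_column_rate_identity
    {n : ℕ} (A : Matrix (Fin n) (Fin n) ℝ) (hA : A.PosDef)
    (c : Fin n → ℝ) (hc : c ≠ 0)
    (z : Fin n → ℝ) (hz : z = A *ᵥ c)
    (s : Fin n → ℝ) (hs : s ≠ 0) (horth : z ⬝ᵥ s = 0)
    (Z : Matrix (Fin n) (Fin 2) ℝ) (hZ : Z = Matrix.of fun i j => ![z i, s i] j)
    (ωz2 ωZ2 : ℝ)
    (hωz : ωz2 = (c ⬝ᵥ A *ᵥ ((1 - Rvec A z) *ᵥ c)) / (c ⬝ᵥ A *ᵥ c))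
    (hωZ : ωZ2 = (c ⬝ᵥ A *ᵥ ((1 - Rmat A Z) *ᵥ c)) / (c ⬝ᵥ A *ᵥ c)) :
    1 - ωZ2 =
      (z ⬝ᵥ z) ^ 2 * (s ⬝ᵥ A *ᵥ s) /
        ((z ⬝ᵥ A⁻¹ *ᵥ z) * ((s ⬝ᵥ A *ᵥ s) * (z ⬝ᵥ A *ᵥ z) - (s ⬝ᵥ A *ᵥ z) ^ 2)) ∧
    (1 - ωz2) / (1 - ωZ2) =
      1 - (s ⬝ᵥ A *ᵥ z) ^ 2 / ((s ⬝ᵥ A *ᵥ s) * (z ⬝ᵥ A *ᵥ z)) ∧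
    (1 - ωz2) / (1 - ωZ2) ≤ 1 ∧
    Real.sqrt ωZ2 ≤ Real.sqrt ωz2 := by
  have hsymm : A.IsSymm := by simpa using hA.isHermitian
  have ha : 0 < c ⬝ᵥ A *ᵥ c := by simpa using hA.dotProduct_mulVec_pos hc
  have hz0 : z ≠ 0 := by
    rintro rfl
    simp [← hz] at ha
  have hp : 0 < z ⬝ᵥ A *ᵥ z := by simpa using hA.dotProduct_mulVec_pos hz0
  have hq : 0 < s ⬝ᵥ A *ᵥ s := by simpa using hA.dotProduct_mulVec_pos hs
  have hN : 0 < z ⬝ᵥ z := by simpa using dotProduct_star_self_pos_iff.2 hz0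
  have hD := sub_pos.2 (hA.sq_dotProduct_mulVec_lt_of_dotProduct_eq_zero hz0 hs horth)
  have hinv : z ⬝ᵥ A⁻¹ *ᵥ z = c ⬝ᵥ A *ᵥ c := by
    rw [hz, mulVec_mulVec, nonsing_inv_mul A ((isUnit_iff_isUnit_det A).1 hA.isUnit),
      one_mulVec, dotProduct_comm]
  have hZz : Zᵀ *ᵥ (A *ᵥ c) = ![z ⬝ᵥ z, 0] := by
    rw [← hz, hZ]
    ext j
    fin_cases j
    · simp [mulVec, dotProduct]
    · simpa [mulVec, dotProduct, mul_comm] using horth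
  have hgram : Zᵀ * A * Z =
      !![z ⬝ᵥ A *ᵥ z, s ⬝ᵥ A *ᵥ z; s ⬝ᵥ A *ᵥ z, s ⬝ᵥ A *ᵥ s] := by
    have key : ∀ i j, (Zᵀ * A * Z) i j = Zᵀ i ⬝ᵥ A *ᵥ Zᵀ j := fun i j => by
      rw [Matrix.mul_assoc]; rfl
    have h0 : Zᵀ 0 = z := by rw [hZ]; rfl
    have h1 : Zᵀ 1 = s := by rw [hZ]; rfl
    ext i j
    rw [key]
    fin_cases i <;> fin_cases j <;> simp [h0, h1, hsymm.dotProduct_mulVec_comm z s]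
  have hRZ : c ⬝ᵥ A *ᵥ (Rmat A Z *ᵥ c) = (z ⬝ᵥ z) ^ 2 * (s ⬝ᵥ A *ᵥ s) /
      ((s ⬝ᵥ A *ᵥ s) * (z ⬝ᵥ A *ᵥ z) - (s ⬝ᵥ A *ᵥ z) ^ 2) := by
    rw [dotProduct_mulVec_Rmat hsymm, hZz, hgram, inv_def, det_fin_two_of, adjugate_fin_two_of,
      Ring.inverse_eq_inv', smul_mulVec, dotProduct_smul]
    simp only [cons_mulVec, cons_dotProduct, dotProduct_of_isEmpty, empty_mulVec, smul_eq_mul,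
      head_cons, tail_cons, mul_zero, zero_mul, add_zero]
    rw [mul_comm (z ⬝ᵥ A *ᵥ z)]
    ring
  have hRz := dotProduct_mulVec_Rvec hsymm z c
  rw [← hz] at hRz
  simp only [sub_mulVec, one_mulVec, mulVec_sub, dotProduct_sub, hRZ] at hωZ
  simp only [sub_mulVec, one_mulVec, mulVec_sub, dotProduct_sub, ← hz, hRz] at hωz
  rw [← hz] at ha hinv hωZ
  rw [hinv]
  generalize c ⬝ᵥ z = a at *
  generalize z ⬝ᵥ A *ᵥ z = p at *
  generalize s ⬝ᵥ A *ᵥ s = q at *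
  generalize s ⬝ᵥ A *ᵥ z = r at *
  generalize z ⬝ᵥ z = N at *
  have e1 : 1 - ωZ2 = N ^ 2 * q / (a * (q * p - r ^ 2)) := by
    rw [hωZ]
    field_simp
    ring
  have e2 : 1 - ωz2 = N ^ 2 / (a * p) := by
    rw [hωz]
    field_simp
    ring
  have e3 : (1 - ωz2) / (1 - ωZ2) = 1 - r ^ 2 / (q * p) := by
    rw [e1, e2]
    field_simp
  have hle : (1 - ωz2) / (1 - ωZ2) ≤ 1 := by
    rw [e3, sub_le_self_iff]
    positivity
  refine ⟨e1, e3, hle, Real.sqrt_le_sqrt ?_⟩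
  have hpos : 0 < 1 - ωZ2 := by
    rw [e1]
    positivity
  rw [div_le_one hpos] at hle
  linarith
end

section
/- (Theorem 2, inner–outer steepest descent.) Let A be a real symmetric positive definite n×n matrix, x_* = A⁻¹y, t an initial guess with error c = x_* − t ≠ 0, z = Ac, and Z an n×m matrix with orthonormal columns such that z̃ = ZZᵀz ≠ 0. Set B = ZᵀAZ, g = Zᵀz, let v_* = B⁻¹g, and let v = g·(‖g‖²/(gᵀBg)) be one steepest descent step for Bv = g from the zero initial guess. Then the error d = x_* − (t + Zv) satisfies d = ( (I − R_Z) + Z(I − Q_g)ZᵀR_Z )c = ( (I − R_Z) + (I − R_{z̃})R_Z )c and ‖d‖_A² = ( ω_Z² + (1 − ω_Z²)ω_g² ) ‖c‖_A², where ω_Z² = (c,(I − R_Z)c)_A/(c,c)_A, Q_g = g gᵀB/(gᵀBg), and ω_g² = 1 − ‖g‖⁴/((g,Bg)(g,B⁻¹g)). -/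
open Matrix

theorem vecMulVec_mul_mulVec {n : Type*} [Fintype n]
    (u : n → ℝ) (M : Matrix n n ℝ) (x : n → ℝ) :
    (Matrix.vecMulVec u u * M) *ᵥ x = (u ⬝ᵥ M *ᵥ x) • u := by
  rw [← Matrix.mulVec_mulVec, Matrix.vecMulVec_mulVec, op_smul_eq_smul]

theorem posDef_transpose_mul_mul {m n : Type*} [Fintype m] [Fintype n] [DecidableEq m]
    {A : Matrix n n ℝ} (hA : A.PosDef) {Z : Matrix n m ℝ} (hZ : Zᵀ * Z = 1) :
    (Zᵀ * A * Z).PosDef := by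
  have hinj : Function.Injective Z.mulVec := fun a b h => by
    simpa [Matrix.mulVec_mulVec, hZ] using congrArg (Zᵀ *ᵥ ·) h
  simpa [Matrix.conjTranspose_eq_transpose_of_trivial] using hA.conjTranspose_mul_mul_same hinj

/-- Theorem 2: one outer Galerkin step followed by one inner
steepest descent step for the reduced problem. -/
theorem inner_outer_steepest_descent
    {n m : ℕ} (A : Matrix (Fin n) (Fin n) ℝ) (hA : A.PosDef)
    (y t xstar c z zt : Fin n → ℝ)
    (Z : Matrix (Fin n) (Fin m) ℝ) (hZ : Zᵀ * Z = 1)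
    (hxstar : xstar = A⁻¹ *ᵥ y)
    (hc : c = xstar - t) (hc0 : c ≠ 0)
    (hz : z = A *ᵥ c)
    (hzt : zt = Z *ᵥ (Zᵀ *ᵥ z)) (hzt0 : zt ≠ 0)
    (B : Matrix (Fin m) (Fin m) ℝ) (hB : B = Zᵀ * A * Z)
    (g : Fin m → ℝ) (hg : g = Zᵀ *ᵥ z)
    (vstar : Fin m → ℝ) (hvstar : vstar = B⁻¹ *ᵥ g)
    (v : Fin m → ℝ) (hv : v = ((g ⬝ᵥ g) / (g ⬝ᵥ B *ᵥ g)) • g)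
    (d : Fin n → ℝ) (hd : d = xstar - (t + Z *ᵥ v))
    (Qg : Matrix (Fin m) (Fin m) ℝ)
    (hQg : Qg = (g ⬝ᵥ B *ᵥ g)⁻¹ • (Matrix.vecMulVec g g * B))
    (ωZ2 ωg2 : ℝ)
    (hωZ : ωZ2 = (c ⬝ᵥ A *ᵥ ((1 - Rmat A Z) *ᵥ c)) / (c ⬝ᵥ A *ᵥ c))
    (hωg : ωg2 = 1 - (g ⬝ᵥ g) ^ 2 / ((g ⬝ᵥ B *ᵥ g) * (g ⬝ᵥ B⁻¹ *ᵥ g))) :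
    d = ((1 - Rmat A Z) + Z * (1 - Qg) * Zᵀ * Rmat A Z) *ᵥ c ∧
    d = ((1 - Rmat A Z) + (1 - Rvec A zt) * Rmat A Z) *ᵥ c ∧
    d ⬝ᵥ A *ᵥ d = (ωZ2 + (1 - ωZ2) * ωg2) * (c ⬝ᵥ A *ᵥ c) := by
  have hBpd : B.PosDef := hB ▸ posDef_transpose_mul_mul hA hZ
  have hAs : Aᵀ = A := by
    simpa [Matrix.conjTranspose_eq_transpose_of_trivial] using hA.isHermitian.eq
  have hg0 : g ≠ 0 := by
    rintro rfl
    exact hzt0 (by rw [hzt, ← hg, Matrix.mulVec_zero])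
  have hq : 0 < g ⬝ᵥ B *ᵥ g := by simpa using hBpd.dotProduct_mulVec_pos hg0
  have hp : 0 < g ⬝ᵥ B⁻¹ *ᵥ g := by simpa using hBpd.inv.dotProduct_mulVec_pos hg0
  have he : 0 < c ⬝ᵥ A *ᵥ c := by simpa using hA.dotProduct_mulVec_pos hc0
  have hBw : B *ᵥ (B⁻¹ *ᵥ g) = g := by
    rw [Matrix.mulVec_mulVec, Matrix.mul_nonsing_inv _ ((Matrix.isUnit_iff_isUnit_det B).1 hBpd.isUnit), Matrix.one_mulVec]
  have hRc : Rmat A Z *ᵥ c = Z *ᵥ (B⁻¹ *ᵥ g) := by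
    rw [Rmat, ← hB, hg, hz]
    simp only [Matrix.mulVec_mulVec, Matrix.mul_assoc]
  have hdc : d = c - Z *ᵥ v := by rw [hd, hc]; abel
  have hZAZ (u x : Fin m → ℝ) : (Z *ᵥ u) ⬝ᵥ A *ᵥ (Z *ᵥ x) = u ⬝ᵥ B *ᵥ x := by
    rw [dotProduct_comm, ← dotProduct_transpose_mulVec, hB]
    simp only [Matrix.mulVec_mulVec, Matrix.mul_assoc]
  have hZAc (u : Fin m → ℝ) : (Z *ᵥ u) ⬝ᵥ A *ᵥ c = u ⬝ᵥ g := by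
    rw [dotProduct_comm, ← dotProduct_transpose_mulVec, hg, hz]
  have hcAZ (u : Fin m → ℝ) : c ⬝ᵥ A *ᵥ (Z *ᵥ u) = u ⬝ᵥ g := by
    rw [← hZAc, ← dotProduct_transpose_mulVec, hAs]
  have hQw : Qg *ᵥ (B⁻¹ *ᵥ g) = v := by
    rw [hQg, Matrix.smul_mulVec, vecMulVec_mul_mulVec, hBw, hv, smul_smul, div_eq_inv_mul]
  have hRw : Rvec A zt *ᵥ (Z *ᵥ (B⁻¹ *ᵥ g)) = Z *ᵥ v := by
    rw [Rvec, hzt, ← hg, Matrix.smul_mulVec, vecMulVec_mul_mulVec, hZAZ, hZAZ, hBw, hv,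
      smul_smul, Matrix.mulVec_smul, div_eq_inv_mul]
  refine ⟨?_, ?_, ?_⟩
  · have hZw (x : Fin m → ℝ) : Zᵀ *ᵥ (Z *ᵥ x) = x := by
      rw [Matrix.mulVec_mulVec, hZ, Matrix.one_mulVec]
    simp only [Matrix.add_mulVec, Matrix.sub_mulVec, Matrix.one_mulVec, ← Matrix.mulVec_mulVec,
      hRc, hZw, hQw, Matrix.mulVec_sub, hdc]
    abel
  · simp only [Matrix.add_mulVec, Matrix.sub_mulVec, Matrix.one_mulVec, ← Matrix.mulVec_mulVec,
      hRc, hRw, hdc]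
    abel
  · have hω : ωZ2 = (c ⬝ᵥ A *ᵥ c - g ⬝ᵥ B⁻¹ *ᵥ g) / (c ⬝ᵥ A *ᵥ c) := by
      rw [hωZ, Matrix.sub_mulVec, Matrix.one_mulVec, hRc, Matrix.mulVec_sub, dotProduct_sub, hcAZ,
        dotProduct_comm (B⁻¹ *ᵥ g)]
    rw [hω, hωg, hdc]
    simp only [Matrix.mulVec_sub, dotProduct_sub, sub_dotProduct, hcAZ, hZAc, hZAZ]
    simp only [hv, Matrix.mulVec_smul, dotProduct_smul, smul_dotProduct, smul_eq_mul]
    field_simp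
    ring
end

section
/- Let A be a real symmetric positive definite n×n matrix and Z an n×m matrix with orthonormal columns. Let z̃ be a nonzero vector in the column span of Z, g = Zᵀz̃, and B = ZᵀAZ. Then the steepest descent rate of the reduced system does not exceed that of the original system: 1 − ‖g‖⁴/((g, Bg)(g, B⁻¹g)) ≤ 1 − ‖z̃‖⁴/((z̃, Az̃)(z̃, A⁻¹z̃)). -/
open Matrix

/-- Compressing a positive definite matrix to a subspace can only decrease the quadratic form of
its inverse. -/
theorem Matrix.PosDef.dotProduct_inv_compression_le {ι κ : Type*} [Fintype ι] [DecidableEq ι]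
    [Fintype κ] [DecidableEq κ] {A : Matrix ι ι ℝ} (hA : A.PosDef) (Z : Matrix ι κ ℝ)
    (hB : (Zᵀ * A * Z).PosDef) (v : ι → ℝ) :
    Zᵀ *ᵥ v ⬝ᵥ (Zᵀ * A * Z)⁻¹ *ᵥ (Zᵀ *ᵥ v) ≤ v ⬝ᵥ A⁻¹ *ᵥ v := by
  have hAx : A *ᵥ (A⁻¹ *ᵥ v) = v := by
    rw [mulVec_mulVec, mul_nonsing_inv _ ((isUnit_iff_isUnit_det _).1 hA.isUnit), one_mulVec]
  have hBy : (Zᵀ * A * Z) *ᵥ ((Zᵀ * A * Z)⁻¹ *ᵥ (Zᵀ *ᵥ v)) = Zᵀ *ᵥ v := by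
    rw [mulVec_mulVec, mul_nonsing_inv _ ((isUnit_iff_isUnit_det _).1 hB.isUnit), one_mulVec]
  set x := A⁻¹ *ᵥ v
  set y := (Zᵀ * A * Z)⁻¹ *ᵥ (Zᵀ *ᵥ v)
  have hpos : 0 ≤ (x - Z *ᵥ y) ⬝ᵥ A *ᵥ (x - Z *ᵥ y) := by
    simpa using hA.posSemidef.dotProduct_mulVec_nonneg (x - Z *ᵥ y)
  have hAt : Aᵀ = A := by simpa using hA.isHermitian.eq
  have hadj (u : ι → ℝ) : (Z *ᵥ y) ⬝ᵥ u = Zᵀ *ᵥ u ⬝ᵥ y := by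
    rw [dotProduct_comm, dotProduct_mulVec, ← mulVec_transpose]
  have hcross : x ⬝ᵥ A *ᵥ (Z *ᵥ y) = Zᵀ *ᵥ v ⬝ᵥ y := by
    rw [dotProduct_mulVec, ← mulVec_transpose, hAt, hAx, dotProduct_mulVec, ← mulVec_transpose]
  have hquad : (Z *ᵥ y) ⬝ᵥ A *ᵥ (Z *ᵥ y) = Zᵀ *ᵥ v ⬝ᵥ y := by
    rw [hadj, mulVec_mulVec, mulVec_mulVec, hBy]
  rw [mulVec_sub, hAx, sub_dotProduct, dotProduct_sub, dotProduct_sub, hcross, hquad, hadj,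
    dotProduct_comm x v] at hpos
  linarith

/-- the steepest descent rate of the Galerkin-reduced system does
not exceed that of the original system. -/
theorem reduced_sd_rate_le
    {n m : ℕ} (A : Matrix (Fin n) (Fin n) ℝ) (hA : A.PosDef)
    (Z : Matrix (Fin n) (Fin m) ℝ) (hZ : Zᵀ * Z = 1)
    (zt : Fin n → ℝ) (hzt0 : zt ≠ 0)
    (hspan : ∃ w : Fin m → ℝ, zt = Z *ᵥ w)
    (g : Fin m → ℝ) (hg : g = Zᵀ *ᵥ zt)
    (B : Matrix (Fin m) (Fin m) ℝ) (hB : B = Zᵀ * A * Z) :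
    1 - (g ⬝ᵥ g) ^ 2 / ((g ⬝ᵥ B *ᵥ g) * (g ⬝ᵥ B⁻¹ *ᵥ g)) ≤
      1 - (zt ⬝ᵥ zt) ^ 2 / ((zt ⬝ᵥ A *ᵥ zt) * (zt ⬝ᵥ A⁻¹ *ᵥ zt)) := by
  obtain ⟨w, hw⟩ := hspan
  have hZg : Z *ᵥ g = zt := by
    rw [hg, hw, mulVec_mulVec w, hZ, one_mulVec]
  have hg0 : g ≠ 0 := fun h => hzt0 (by rw [← hZg, h, mulVec_zero])
  have hinj : Function.Injective Z.mulVec := fun u v huv => by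
    simpa [mulVec_mulVec, hZ] using congrArg (Zᵀ *ᵥ ·) huv
  have hBpos : B.PosDef := by
    simpa [hB] using hA.conjTranspose_mul_mul_same hinj
  have hadj (u : Fin n → ℝ) : zt ⬝ᵥ u = g ⬝ᵥ Zᵀ *ᵥ u := by
    rw [dotProduct_mulVec, ← mulVec_transpose, transpose_transpose, hZg]
  have hnorm : zt ⬝ᵥ zt = g ⬝ᵥ g := by rw [hadj, ← hg]
  have hquad : zt ⬝ᵥ A *ᵥ zt = g ⬝ᵥ B *ᵥ g := by
    rw [hadj, hB, ← mulVec_mulVec, hZg, ← mulVec_mulVec]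
  have hinv : g ⬝ᵥ B⁻¹ *ᵥ g ≤ zt ⬝ᵥ A⁻¹ *ᵥ zt := by
    subst hB hg
    exact hA.dotProduct_inv_compression_le Z hBpos zt
  have hb : 0 < g ⬝ᵥ B *ᵥ g := by simpa using hBpos.dotProduct_mulVec_pos hg0
  have hc : 0 < g ⬝ᵥ B⁻¹ *ᵥ g := by simpa using hBpos.inv.dotProduct_mulVec_pos hg0
  rw [hnorm, hquad]
  gcongr
end

section
/- Let A be a real symmetric positive definite n×n matrix, Z an n×m matrix with orthonormal columns, z ∈ ℝ^n with z̃ = ZZᵀz ≠ 0, B = ZᵀAZ, g = Zᵀz, and Q_g = g gᵀB/(gᵀBg). Then Z Q_g Zᵀ = R_{z̃} Z Zᵀ and Z Zᵀ R_Z = R_Z; consequently Z Q_g Zᵀ R_Z = R_{z̃} R_Z. -/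
open Matrix

/-- projector identities relating the reduced and original
steepest descent projectors. -/
theorem projector_identities
    {n m : ℕ} (A : Matrix (Fin n) (Fin n) ℝ) (hA : A.PosDef)
    (Z : Matrix (Fin n) (Fin m) ℝ) (hZ : Zᵀ * Z = 1)
    (z zt : Fin n → ℝ) (hzt : zt = Z *ᵥ (Zᵀ *ᵥ z)) (hzt0 : zt ≠ 0)
    (B : Matrix (Fin m) (Fin m) ℝ) (hB : B = Zᵀ * A * Z)
    (g : Fin m → ℝ) (hg : g = Zᵀ *ᵥ z)
    (Qg : Matrix (Fin m) (Fin m) ℝ)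
    (hQg : Qg = (g ⬝ᵥ B *ᵥ g)⁻¹ • (Matrix.vecMulVec g g * B)) :
    Z * Qg * Zᵀ = Rvec A zt * (Z * Zᵀ) ∧
    Z * Zᵀ * Rmat A Z = Rmat A Z ∧
    Z * Qg * Zᵀ * Rmat A Z = Rvec A zt * Rmat A Z := by
  have quad : (Z *ᵥ g) ⬝ᵥ A *ᵥ (Z *ᵥ g) = g ⬝ᵥ B *ᵥ g := by
    rw [hB, ← mulVec_mulVec, ← mulVec_mulVec, dotProduct_mulVec g, vecMul_transpose]
  have outer : vecMulVec (Z *ᵥ g) (Z *ᵥ g) = Z * vecMulVec g g * Zᵀ := by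
    rw [mul_vecMulVec, vecMulVec_mul, vecMul_transpose]
  have reduced : Z * Qg * Zᵀ = Rvec A zt * (Z * Zᵀ) := by
    rw [hzt, ← hg, Rvec, quad, outer, hQg, hB]
    simp only [Matrix.mul_smul, Matrix.smul_mul, Matrix.mul_assoc]
  have range : Z * Zᵀ * Rmat A Z = Rmat A Z := by
    simp only [Rmat, ← Matrix.mul_assoc]
    rw [Matrix.mul_assoc Z, hZ, Matrix.mul_one]
  refine ⟨reduced, range, ?_⟩
  rw [reduced, Matrix.mul_assoc, range]
end

section
/- Let A be a real symmetric positive definite n×n matrix, x_* = A⁻¹y, t an initial guess with error c = x_* − t, z = Ac, Z an n×m matrix with orthonormal columns, B = ZᵀAZ, g = Zᵀz, and v_* = B⁻¹g. Then for every v ∈ ℝ^m, the error of the update x = t + Zv satisfies the A-orthogonal decomposition d = x_* − x = (I − R_Z)c + Z(v_* − v) with ‖d‖_A² = ‖(I − R_Z)c‖_A² + ‖v_* − v‖_B². -/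
open Matrix

/-- `‖p + Zw‖_A² = ‖p‖_A² + ‖w‖²_{ZᵀAZ}` when `p` is A-orthogonal to the column span of `Z`. -/
theorem dotProduct_mulVec_add_of_orthogonal {n m : ℕ} {A : Matrix (Fin n) (Fin n) ℝ}
    (hA : Aᵀ = A) (Z : Matrix (Fin n) (Fin m) ℝ) (p : Fin n → ℝ) (w : Fin m → ℝ)
    (hp : Zᵀ *ᵥ (A *ᵥ p) = 0) :
    (p + Z *ᵥ w) ⬝ᵥ A *ᵥ (p + Z *ᵥ w) = p ⬝ᵥ A *ᵥ p + w ⬝ᵥ (Zᵀ * A * Z) *ᵥ w := by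
  have move (u : Fin n → ℝ) : (Z *ᵥ w) ⬝ᵥ u = w ⬝ᵥ Zᵀ *ᵥ u := by
    rw [dotProduct_mulVec, vecMul_transpose]
  have cross : (Z *ᵥ w) ⬝ᵥ A *ᵥ p = 0 := by
    rw [move, hp, dotProduct_zero]
  have cross' : p ⬝ᵥ A *ᵥ (Z *ᵥ w) = 0 := by
    rw [dotProduct_mulVec, ← mulVec_transpose, hA, dotProduct_comm, cross]
  rw [mulVec_add, add_dotProduct, dotProduct_add, dotProduct_add, cross, cross',
    move (A *ᵥ (Z *ᵥ w))]
  simp only [mulVec_mulVec, Matrix.mul_assoc, add_zero, zero_add]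

/-- The Gram matrix `ZᵀAZ` of linearly independent columns is invertible. -/
theorem isUnit_det_transpose_mul_mul {n m : ℕ} {A : Matrix (Fin n) (Fin n) ℝ}
    (hA : A.PosDef) {Z : Matrix (Fin n) (Fin m) ℝ} (hZ : Function.Injective Z.mulVec) :
    IsUnit (Zᵀ * A * Z).det := by
  have h := hA.conjTranspose_mul_mul_same hZ
  rw [conjTranspose_eq_transpose_of_trivial] at h
  exact h.det_pos.ne'.isUnit

/-- The residual of the projector `R_Z` is A-orthogonal to the column span of `Z`. -/
theorem transpose_mul_mul_one_sub_Rmat {n m : ℕ} {A : Matrix (Fin n) (Fin n) ℝ}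
    {Z : Matrix (Fin n) (Fin m) ℝ} (h : IsUnit (Zᵀ * A * Z).det) :
    Zᵀ * A * (1 - Rmat A Z) = 0 := by
  have key : Zᵀ * A * Rmat A Z = (Zᵀ * A * Z) * (Zᵀ * A * Z)⁻¹ * (Zᵀ * A) := by
    simp only [Rmat, Matrix.mul_assoc]
  rw [Matrix.mul_sub, Matrix.mul_one, key, mul_nonsing_inv _ h, Matrix.one_mul, sub_self]

/-- A-orthogonal decomposition of the error of a subspace update. -/
theorem error_orthogonal_decomposition
    {n m : ℕ} (A : Matrix (Fin n) (Fin n) ℝ) (hA : A.PosDef)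
    (y t xstar c z : Fin n → ℝ)
    (hxstar : xstar = A⁻¹ *ᵥ y)
    (hc : c = xstar - t)
    (hz : z = A *ᵥ c)
    (Z : Matrix (Fin n) (Fin m) ℝ) (hZ : Zᵀ * Z = 1)
    (B : Matrix (Fin m) (Fin m) ℝ) (hB : B = Zᵀ * A * Z)
    (g : Fin m → ℝ) (hg : g = Zᵀ *ᵥ z)
    (vstar : Fin m → ℝ) (hvstar : vstar = B⁻¹ *ᵥ g) :
    ∀ v : Fin m → ℝ,
      xstar - (t + Z *ᵥ v) = (1 - Rmat A Z) *ᵥ c + Z *ᵥ (vstar - v) ∧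
      (xstar - (t + Z *ᵥ v)) ⬝ᵥ A *ᵥ (xstar - (t + Z *ᵥ v)) =
        ((1 - Rmat A Z) *ᵥ c) ⬝ᵥ A *ᵥ ((1 - Rmat A Z) *ᵥ c) +
          (vstar - v) ⬝ᵥ B *ᵥ (vstar - v) := by
  intro v
  have hinj : Function.Injective Z.mulVec := by
    refine Function.LeftInverse.injective (g := Zᵀ.mulVec) fun x => ?_
    rw [mulVec_mulVec, hZ, one_mulVec]
  have hdec : xstar - (t + Z *ᵥ v) = (1 - Rmat A Z) *ᵥ c + Z *ᵥ (vstar - v) := by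
    have hproj : Rmat A Z *ᵥ c = Z *ᵥ vstar := by
      rw [hvstar, hg, hz, hB]
      simp only [Rmat, mulVec_mulVec, Matrix.mul_assoc]
    rw [sub_mulVec, one_mulVec, hproj, mulVec_sub, hc]
    abel
  refine ⟨hdec, ?_⟩
  have hsymm : Aᵀ = A := by
    rw [← conjTranspose_eq_transpose_of_trivial]
    exact hA.isHermitian
  rw [hdec, hB]
  refine dotProduct_mulVec_add_of_orthogonal hsymm Z _ _ ?_
  rw [mulVec_mulVec, mulVec_mulVec,
    transpose_mul_mul_one_sub_Rmat (isUnit_det_transpose_mul_mul hA hinj), zero_mulVec]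
end

section
/- Let A be a real symmetric positive definite n×n matrix, c ∈ ℝ^n, z = Ac, and Z an n×m matrix with orthonormal columns such that z̃ = ZZᵀz ≠ 0. Set B = ZᵀAZ, g = Zᵀz, v_* = B⁻¹g, and let v = g·(‖g‖²/(gᵀBg)) be one steepest descent step for Bv = g from the zero initial guess. Then Z(v_* − v) = R_Z c − R_{z̃} c, and hence the combined error satisfies (I − R_Z)c + Z(v_* − v) = (I − R_{z̃})c; i.e., one outer Galerkin step combined with one inner steepest descent step is equivalent to the perturbed steepest descent step with direction z̃. -/
open Matrix

/-- one outer Galerkin step plus one inner steepest descent step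
equals the perturbed steepest descent step with direction `z̃`. -/
theorem inner_outer_equals_perturbed_sd
    {n m : ℕ} (A : Matrix (Fin n) (Fin n) ℝ) (hA : A.PosDef)
    (c z zt : Fin n → ℝ) (hz : z = A *ᵥ c)
    (Z : Matrix (Fin n) (Fin m) ℝ) (hZ : Zᵀ * Z = 1)
    (hzt : zt = Z *ᵥ (Zᵀ *ᵥ z)) (hzt0 : zt ≠ 0)
    (B : Matrix (Fin m) (Fin m) ℝ) (hB : B = Zᵀ * A * Z)
    (g : Fin m → ℝ) (hg : g = Zᵀ *ᵥ z)
    (vstar : Fin m → ℝ) (hvstar : vstar = B⁻¹ *ᵥ g)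
    (v : Fin m → ℝ) (hv : v = ((g ⬝ᵥ g) / (g ⬝ᵥ B *ᵥ g)) • g) :
    Z *ᵥ (vstar - v) = Rmat A Z *ᵥ c - Rvec A zt *ᵥ c ∧
    (1 - Rmat A Z) *ᵥ c + Z *ᵥ (vstar - v) = (1 - Rvec A zt) *ᵥ c := by
  have hRmat : Rmat A Z *ᵥ c = Z *ᵥ vstar := by
    simp only [Rmat, hvstar, hg, hz, hB, mulVec_mulVec, Matrix.mul_assoc]
  have hnum : zt ⬝ᵥ A *ᵥ c = g ⬝ᵥ g := by
    rw [← hz, hzt, ← hg, dotProduct_comm, dotProduct_mulVec, ← mulVec_transpose, ← hg]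
  have hden : zt ⬝ᵥ A *ᵥ zt = g ⬝ᵥ B *ᵥ g := by
    rw [hzt, ← hg, hB, dotProduct_comm, dotProduct_mulVec, ← mulVec_transpose, dotProduct_comm]
    simp only [mulVec_mulVec, Matrix.mul_assoc]
  have hRvec : Rvec A zt *ᵥ c = Z *ᵥ v := by
    rw [Rvec, smul_mulVec, ← mulVec_mulVec, vecMulVec_mulVec, hnum, hden, hv, mulVec_smul, hg,
      ← hzt, op_smul_eq_smul, smul_smul, div_eq_inv_mul]
  have hdiff : Z *ᵥ (vstar - v) = Rmat A Z *ᵥ c - Rvec A zt *ᵥ c := by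
    rw [mulVec_sub, hRmat, hRvec]
  refine ⟨hdiff, ?_⟩
  rw [hdiff, sub_mulVec, sub_mulVec]
  abel
end

section
/- Let A be a real symmetric positive definite n×n matrix and U an n×m matrix with orthonormal columns (UᵀU = I). Then UᵀA⁻¹U − (UᵀAU)⁻¹ is positive semidefinite; in particular, for every w ∈ ℝ^m, (w, (UᵀAU)⁻¹w) ≤ (w, UᵀA⁻¹Uw). -/
open Matrix

/-- With `B = UᵀAU`, the gap `UᵀA⁻¹U - B⁻¹` is the congruence of `A` by `A⁻¹U - UB⁻¹`. -/
theorem transpose_mul_inv_mul_sub_inv_eq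
    {ι κ R : Type*} [Fintype ι] [DecidableEq ι] [Fintype κ] [DecidableEq κ] [CommRing R]
    (A : Matrix ι ι R) (hAt : Aᵀ = A) (hA : IsUnit A.det)
    (U : Matrix ι κ R) (hU : Uᵀ * U = 1) (hB : IsUnit (Uᵀ * A * U).det) :
    Uᵀ * A⁻¹ * U - (Uᵀ * A * U)⁻¹ =
      (A⁻¹ * U - U * (Uᵀ * A * U)⁻¹)ᵀ * A * (A⁻¹ * U - U * (Uᵀ * A * U)⁻¹) := by
  have hBt : (Uᵀ * A * U)ᵀ = Uᵀ * A * U := by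
    simp [transpose_mul, hAt, Matrix.mul_assoc]
  have hBB : Uᵀ * A * U * (Uᵀ * A * U)⁻¹ = 1 := mul_nonsing_inv _ hB
  set C := (Uᵀ * A * U)⁻¹ with hC
  have hCt : Cᵀ = C := by rw [hC, transpose_nonsing_inv, hBt]
  have hAX : A * (A⁻¹ * U - U * C) = U - A * U * C := by
    rw [Matrix.mul_sub, mul_nonsing_inv_cancel_left _ _ hA, Matrix.mul_assoc]
  have hAU : Uᵀ * A⁻¹ * (A * U * C) = C := by
    rw [Matrix.mul_assoc Uᵀ, Matrix.mul_assoc A, nonsing_inv_mul_cancel_left _ _ hA,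
      ← Matrix.mul_assoc, hU, Matrix.one_mul]
  have hUAU : Uᵀ * (A * U * C) = 1 := by
    rw [← hBB]; simp only [Matrix.mul_assoc]
  rw [Matrix.mul_assoc _ A, hAX, transpose_sub, transpose_mul, transpose_mul,
    transpose_nonsing_inv, hAt, hCt, Matrix.sub_mul, Matrix.mul_sub, Matrix.mul_sub, hAU,
    Matrix.mul_assoc C, Matrix.mul_assoc C, hU, hUAU, sub_self, sub_zero]

/-- Kantorovich-type inequality `(UᵀAU)⁻¹ ≤ UᵀA⁻¹U`. -/
theorem reduced_inverse_le
    {n m : ℕ} (A : Matrix (Fin n) (Fin n) ℝ) (hA : A.PosDef)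
    (U : Matrix (Fin n) (Fin m) ℝ) (hU : Uᵀ * U = 1) :
    (Uᵀ * A⁻¹ * U - (Uᵀ * A * U)⁻¹).PosSemidef ∧
    ∀ w : Fin m → ℝ, w ⬝ᵥ (Uᵀ * A * U)⁻¹ *ᵥ w ≤ w ⬝ᵥ (Uᵀ * A⁻¹ * U) *ᵥ w := by
  have hinj : Function.Injective U.mulVec := fun x y hxy => by
    simpa [hU] using congrArg (Uᵀ *ᵥ ·) hxy
  have hB : (Uᵀ * A * U).PosDef := by
    simpa using hA.conjTranspose_mul_mul_same hinj
  have hAt : Aᵀ = A := by simpa using hA.isHermitian.eq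
  have hpsd : (Uᵀ * A⁻¹ * U - (Uᵀ * A * U)⁻¹).PosSemidef := by
    rw [transpose_mul_inv_mul_sub_inv_eq A hAt hA.det_pos.ne'.isUnit U hU hB.det_pos.ne'.isUnit]
    simpa using hA.posSemidef.conjTranspose_mul_mul_same
      (A⁻¹ * U - U * (Uᵀ * A * U)⁻¹)
  refine ⟨hpsd, fun w => ?_⟩
  have h := hpsd.dotProduct_mulVec_nonneg w
  rw [sub_mulVec, dotProduct_sub] at h
  simpa using h
end
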